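/- Let q ≥ 2 be an integer and let Π be a projective plane of order q. Then Π contains a saturating set S with |S| ≤ √(3(q+1)·ln q) + (1/2)·√q + 3. -/

import Mathlib

/-- A (not necessarily Desarguesian) projective plane of order `q`:
a finite incidence structure of points and lines such that any two distinct
points lie on a unique common line, any two distinct lines meet in a unique
point, there exist four points no three collinear, and every line contains
exactly `q + 1` points. -/
structure ProjPlane (q : ℕ) where
  Point : Type
  Line : Type
  finite_point : Finite Point
  finite_line : Finite Line
  incid : Point → Line → Prop
  line_unique : ∀ P Q : Point, P ≠ Q → ∃! l : Line, incid P l ∧ incid Q l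
  point_unique : ∀ l m : Line, l ≠ m → ∃! P : Point, incid P l ∧ incid P m
  nondeg : ∃ P₁ P₂ P₃ P₄ : Point,
    P₁ ≠ P₂ ∧ P₁ ≠ P₃ ∧ P₁ ≠ P₄ ∧ P₂ ≠ P₃ ∧ P₂ ≠ P₄ ∧ P₃ ≠ P₄ ∧
    (∀ l : Line, ¬(incid P₁ l ∧ incid P₂ l ∧ incid P₃ l)) ∧
    (∀ l : Line, ¬(incid P₁ l ∧ incid P₂ l ∧ incid P₄ l)) ∧
    (∀ l : Line, ¬(incid P₁ l ∧ incid P₃ l ∧ incid P₄ l)) ∧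
    (∀ l : Line, ¬(incid P₂ l ∧ incid P₃ l ∧ incid P₄ l))
  line_card : ∀ l : Line, Nat.card {P : Point // incid P l} = q + 1

/-- A point set `S` is saturating if every point of the plane not in `S`
lies on a line containing at least two points of `S`. -/
def ProjPlane.Saturating {q : ℕ} (PP : ProjPlane q) (S : Set PP.Point) : Prop :=
  ∀ Q : PP.Point, Q ∉ S → ∃ A ∈ S, ∃ B ∈ S, A ≠ B ∧
    ∃ l : PP.Line, PP.incid A l ∧ PP.incid B l ∧ PP.incid Q l

/-- `R(T)`: the set of points of the plane not in `T` that do not lie on any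
line containing at least two points of `T` (the points not covered by `T`). -/
def ProjPlane.uncov {q : ℕ} (PP : ProjPlane q) (T : Set PP.Point) : Set PP.Point :=
  {Q : PP.Point | Q ∉ T ∧ ¬ ∃ A ∈ T, ∃ B ∈ T, A ≠ B ∧
    ∃ l : PP.Line, PP.incid A l ∧ PP.incid B l ∧ PP.incid Q l}

namespace ProjPlane

variable {q : ℕ} (PP : ProjPlane q)

theorem incid_eq_or_eq {A B : PP.Point} {l m : PP.Line} (hAl : PP.incid A l) (hBl : PP.incid B l)
    (hAm : PP.incid A m) (hBm : PP.incid B m) : A = B ∨ l = m := by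
  by_contra! h
  exact h.2 ((PP.line_unique A B h.1).unique ⟨hAl, hBl⟩ ⟨hAm, hBm⟩)

theorem ncard_points_on (l : PP.Line) : {P | PP.incid P l}.ncard = q + 1 :=
  PP.line_card l

theorem card_filter_incid [Fintype PP.Point] (l : PP.Line)
    [DecidablePred fun P => PP.incid P l] :
    (Finset.univ.filter fun P => PP.incid P l).card = q + 1 := by
  rw [← PP.ncard_points_on l, ← Set.ncard_coe_finset]
  simp

/-- A plane of order `q` has at most `q ^ 2 + q + 1` points. -/
theorem card_point_le : Nat.card PP.Point ≤ q ^ 2 + q + 1 := by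
  classical
  have := PP.finite_point
  cases nonempty_fintype PP.Point
  obtain ⟨A, B, P, -, hAB, -, -, -, -, -, hABP, -⟩ := PP.nondeg
  obtain ⟨l, ⟨hAl, hBl⟩, -⟩ := PP.line_unique A B hAB
  have hPl : ¬ PP.incid P l := fun h => hABP l ⟨hAl, hBl, h⟩
  have join : ∀ X, ∃ m, PP.incid P m ∧ PP.incid X m := by
    intro X
    rcases eq_or_ne P X with rfl | h
    · obtain ⟨m, hm, -⟩ := PP.line_unique P A (fun h => hPl (h ▸ hAl))
      exact ⟨m, hm.1, hm.1⟩
    · exact (PP.line_unique P X h).exists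
  choose f hPf hXf using join
  have hcover : (Finset.univ : Finset PP.Point) ⊆ insert P
      ((Finset.univ.filter fun X => PP.incid X l).biUnion
        fun X => (Finset.univ.filter fun Y => PP.incid Y (f X)).erase P) := by
    intro Y _
    by_cases hY : Y = P
    · simp [hY]
    · have hne : f Y ≠ l := fun h => hPl (h ▸ hPf Y)
      obtain ⟨X, ⟨hXY, hXl⟩, -⟩ := PP.point_unique (f Y) l hne
      have hPX : P ≠ X := fun h => hPl (h ▸ hXl)
      have hfX : f X = f Y :=
        (PP.incid_eq_or_eq (hPf X) (hXf X) (hPf Y) hXY).resolve_left hPX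
      simp only [Finset.mem_insert, Finset.mem_biUnion, Finset.mem_filter, Finset.mem_univ,
        true_and, Finset.mem_erase]
      exact Or.inr ⟨X, hXl, hY, hfX ▸ hXf Y⟩
  have h₁ := Finset.card_le_card hcover
  have h₂ := Finset.card_biUnion_le_card_mul (Finset.univ.filter fun X => PP.incid X l)
    (fun X => (Finset.univ.filter fun Y => PP.incid Y (f X)).erase P) q (by
      intro X _
      rw [Finset.card_erase_of_mem (by simp [hPf X]), PP.card_filter_incid]
      simp)
  rw [PP.card_filter_incid] at h₂
  rw [Nat.card_eq_fintype_card, ← Finset.card_univ]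
  calc _ ≤ _ := h₁
    _ ≤ _ := Finset.card_insert_le _ _
    _ ≤ (q + 1) * q + 1 := by omega
    _ = _ := by ring

theorem saturating_of_uncov_eq_empty {T : Set PP.Point} (h : PP.uncov T = ∅) :
    PP.Saturating T := by
  intro Q hQ
  by_contra hc
  exact (h ▸ (⟨hQ, hc⟩ : Q ∈ PP.uncov T) : Q ∈ (∅ : Set PP.Point))

theorem uncov_anti {T U : Set PP.Point} (h : T ⊆ U) : PP.uncov U ⊆ PP.uncov T := by
  rintro Q ⟨hQ, hc⟩
  refine ⟨fun hT => hQ (h hT), ?_⟩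
  rintro ⟨A, hA, B, hB, hAB⟩
  exact hc ⟨A, h hA, B, h hB, hAB⟩

theorem eq_of_mem_uncov {T : Set PP.Point} {Q A B : PP.Point} (hQ : Q ∈ PP.uncov T)
    (hA : A ∈ T) (hB : B ∈ T) {l : PP.Line} (hAl : PP.incid A l) (hBl : PP.incid B l)
    (hQl : PP.incid Q l) : A = B := by
  by_contra h
  exact hQ.2 ⟨A, hA, B, hB, h, l, hAl, hBl, hQl⟩

theorem notMem_uncov_insert {T : Set PP.Point} {Q A P : PP.Point} (hA : A ∈ T) (hAP : A ≠ P)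
    {l : PP.Line} (hAl : PP.incid A l) (hPl : PP.incid P l) (hQl : PP.incid Q l) :
    Q ∉ PP.uncov (insert P T) := fun h =>
  hAP (PP.eq_of_mem_uncov h (Set.mem_insert_of_mem _ hA) (Set.mem_insert _ _) hAl hPl hQl)

/-- Any two uncovered points can be covered by adding a single point. -/
theorem exists_insert_covering_pair {T : Set PP.Point} {A B Q R : PP.Point} (hA : A ∈ T)
    (hB : B ∈ T) (hAB : A ≠ B) (hQ : Q ∈ PP.uncov T) (hR : R ∈ PP.uncov T) :
    ∃ P, Q ∉ PP.uncov (insert P T) ∧ R ∉ PP.uncov (insert P T) := by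
  obtain ⟨l, ⟨hQl, hAl⟩, -⟩ := PP.line_unique Q A (fun h => hQ.1 (h ▸ hA))
  obtain ⟨m, ⟨hRm, hBm⟩, -⟩ := PP.line_unique R B (fun h => hR.1 (h ▸ hB))
  have hlm : l ≠ m := by
    rintro rfl
    exact hAB (PP.eq_of_mem_uncov hQ hA hB hAl hBm hQl)
  obtain ⟨P, ⟨hPl, hPm⟩, -⟩ := PP.point_unique l m hlm
  refine ⟨P, PP.notMem_uncov_insert hA ?_ hAl hPl hQl, PP.notMem_uncov_insert hB ?_ hBm hPm hRm⟩
  · rintro rfl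
    exact hAB (PP.eq_of_mem_uncov hR hA hB hPm hBm hRm)
  · rintro rfl
    exact hAB (PP.eq_of_mem_uncov hQ hA hB hAl hPl hQl)

/-- If at most `2 * n` points are uncovered, then `n` further points suffice. -/
theorem exists_saturating_of_ncard_uncov_le (n : ℕ) (T : Set PP.Point) (hT : 2 ≤ T.ncard)
    (hn : (PP.uncov T).ncard ≤ 2 * n) :
    ∃ S, PP.Saturating S ∧ S.ncard ≤ T.ncard + n := by
  have := PP.finite_point
  induction n generalizing T with
  | zero =>
    refine ⟨T, PP.saturating_of_uncov_eq_empty ?_, by simp⟩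
    exact (Set.ncard_eq_zero (Set.toFinite _)).1 (by omega)
  | succ n ih =>
    rcases (PP.uncov T).eq_empty_or_nonempty with h | ⟨Q, hQ⟩
    · exact ⟨T, PP.saturating_of_uncov_eq_empty h, by omega⟩
    obtain ⟨A, hA, B, hB, hAB⟩ := (Set.one_lt_ncard (Set.toFinite _)).1 (by omega : 1 < T.ncard)
    suffices ∃ P, (PP.uncov (insert P T)).ncard ≤ 2 * n by
      obtain ⟨P, hP⟩ := this
      have hle := Set.ncard_le_ncard (Set.subset_insert P T) (Set.toFinite _)
      obtain ⟨S, hS, hcard⟩ := ih (insert P T) (hT.trans hle) hP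
      exact ⟨S, hS, hcard.trans (by have := Set.ncard_insert_le P T; omega)⟩
    by_cases hR : ∃ R ∈ PP.uncov T, R ≠ Q
    · obtain ⟨R, hR, hRQ⟩ := hR
      obtain ⟨P, hPQ, hPR⟩ := PP.exists_insert_covering_pair hA hB hAB hQ hR
      refine ⟨P, ?_⟩
      have hsub : PP.uncov (insert P T) ⊆ PP.uncov T \ {Q, R} := by
        intro X hX
        refine ⟨PP.uncov_anti (Set.subset_insert _ _) hX, ?_⟩
        rintro (rfl | rfl)
        exacts [hPQ hX, hPR hX]
      have h₁ := Set.ncard_le_ncard hsub (Set.toFinite _)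
      have h₂ := Set.ncard_sdiff_add_ncard_of_subset (s := {Q, R}) (t := PP.uncov T) (by
        rintro X (rfl | rfl)
        exacts [hQ, hR]) (Set.toFinite _)
      rw [Set.ncard_pair hRQ.symm] at h₂
      omega
    · push Not at hR
      refine ⟨Q, ?_⟩
      have hempty : PP.uncov (insert Q T) = ∅ := by
        refine Set.eq_empty_iff_forall_notMem.2 fun X hX => ?_
        have := hR X (PP.uncov_anti (Set.subset_insert _ _) hX)
        exact hX.1 (Set.mem_insert_iff.2 (Or.inl this))
      simp [hempty]

/-- An uncovered point gets covered by at least `#T * (q - 1) + 1` choices of a new point. -/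
theorem le_card_covering [Fintype PP.Point] [DecidableEq PP.Point] (T : Finset PP.Point)
    {Q : PP.Point} (hQ : Q ∈ PP.uncov T)
    [DecidablePred fun P => Q ∉ PP.uncov (insert P (T : Set PP.Point))] :
    T.card * (q - 1) + 1 ≤
      (Tᶜ.filter fun P => Q ∉ PP.uncov (insert P (T : Set PP.Point))).card := by
  classical
  have hne : ∀ A ∈ T, Q ≠ A := fun A hA h => hQ.1 (h ▸ hA)
  have join : ∀ A, ∃ m, A ∈ T → PP.incid Q m ∧ PP.incid A m := by
    intro A
    by_cases hA : A ∈ T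
    · obtain ⟨m, hm, -⟩ := PP.line_unique Q A (hne A hA)
      exact ⟨m, fun _ => hm⟩
    · obtain ⟨R, S, -, -, h, -⟩ := PP.nondeg
      obtain ⟨m, -⟩ := PP.line_unique R S h
      exact ⟨m, fun h => absurd h hA⟩
  choose f hf using join
  let pencil : Finset PP.Point :=
    T.biUnion fun A => ((Finset.univ.filter fun Y => PP.incid Y (f A)).erase A).erase Q
  have hcard : pencil.card = T.card * (q - 1) := by
    rw [Finset.card_biUnion, Finset.sum_const_nat (m := q - 1)]
    · intro A hA
      rw [Finset.card_erase_of_mem (by simp [hne A hA, hf A hA]),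
        Finset.card_erase_of_mem (by simp [hf A hA]), PP.card_filter_incid]
      omega
    · intro A hA B hB hAB
      rw [Function.onFun, Finset.disjoint_left]
      intro X hX hX'
      simp only [Finset.mem_erase, Finset.mem_filter, Finset.mem_univ, true_and] at hX hX'
      rcases PP.incid_eq_or_eq hX.2.2 (hf A hA).1 hX'.2.2 (hf B hB).1 with h | h
      · exact hX.1 h
      · exact hAB (PP.eq_of_mem_uncov hQ hA hB (hf A hA).2 (h ▸ (hf B hB).2) (hf A hA).1)
  have hQp : Q ∉ pencil := by simp [pencil]
  rw [← hcard, ← Finset.card_insert_of_notMem hQp]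
  refine Finset.card_le_card fun X hX => ?_
  rw [Finset.mem_filter, Finset.mem_compl]
  rcases Finset.mem_insert.1 hX with rfl | hX
  · exact ⟨hQ.1, fun h => h.1 (Set.mem_insert _ _)⟩
  · simp only [pencil, Finset.mem_biUnion, Finset.mem_erase, Finset.mem_filter, Finset.mem_univ,
      true_and] at hX
    obtain ⟨A, hA, hXQ, hXA, hXl⟩ := hX
    exact ⟨fun hXT => hXA (PP.eq_of_mem_uncov hQ hXT hA hXl (hf A hA).2 (hf A hA).1),
      PP.notMem_uncov_insert hA hXA.symm (hf A hA).2 hXl (hf A hA).1⟩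

/-- Averaging over all candidate points: some point covers at least the average number of
uncovered points. -/
theorem exists_insert_ncard_uncov_le (hq : 1 ≤ q) (T : Finset PP.Point)
    (hne : (PP.uncov T).Nonempty) :
    ∃ P ∉ T, ((PP.uncov (insert P (T : Set PP.Point))).ncard : ℝ) * (q ^ 2 + q + 1 - T.card) ≤
      (PP.uncov T).ncard * ((q ^ 2 + q + 1 - T.card) - (T.card * (q - 1) + 1)) := by
  classical
  have := PP.finite_point
  cases nonempty_fintype PP.Point
  set R : Finset PP.Point := Finset.univ.filter (· ∈ PP.uncov T) with hR
  have hRcoe : (PP.uncov T).ncard = R.card := by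
    rw [← Set.ncard_coe_finset]
    congr 1
    ext
    simp [hR]
  let cov : PP.Point → Finset PP.Point :=
    fun P => R.filter fun Q => Q ∉ PP.uncov (insert P (T : Set PP.Point))
  have hsum : R.card * (T.card * (q - 1) + 1) ≤ ∑ P ∈ Tᶜ, (cov P).card := by
    have := Finset.sum_card_bipartiteAbove_eq_sum_card_bipartiteBelow (s := Tᶜ) (t := R)
      (fun P Q => Q ∉ PP.uncov (insert P (T : Set PP.Point)))
    refine le_trans ?_ this.ge
    rw [← smul_eq_mul]
    refine Finset.card_nsmul_le_sum _ _ _ fun Q hQ => ?_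
    exact PP.le_card_covering T (by simpa [hR] using hQ)
  obtain ⟨Q, hQ⟩ := hne
  have hTc : Tᶜ.Nonempty := ⟨Q, by simpa using hQ.1⟩
  have havg : ∃ P ∈ Tᶜ, R.card * (T.card * (q - 1) + 1) ≤ Tᶜ.card * (cov P).card := by
    by_contra! h
    have h₁ := Finset.sum_lt_sum_of_nonempty hTc h
    rw [← Finset.mul_sum, Finset.sum_const, smul_eq_mul] at h₁
    exact absurd h₁ (not_lt.2 (Nat.mul_le_mul_left _ hsum))
  obtain ⟨P, hP, hPc⟩ := havg
  refine ⟨P, Finset.mem_compl.1 hP, ?_⟩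
  have hsplit : (PP.uncov (insert P (T : Set PP.Point))).ncard + (cov P).card ≤ R.card := by
    have hco : (PP.uncov (insert P (T : Set PP.Point))).ncard =
        (R.filter fun Q => Q ∈ PP.uncov (insert P (T : Set PP.Point))).card := by
      rw [← Set.ncard_coe_finset]
      congr 1
      ext X
      have : X ∈ PP.uncov (insert P (T : Set PP.Point)) → X ∈ PP.uncov T :=
        fun h => PP.uncov_anti (Set.subset_insert _ _) h
      simpa [hR] using this
    rw [hco, Finset.card_filter_add_card_filter_not]
  have hN : Tᶜ.card + T.card ≤ q ^ 2 + q + 1 := by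
    have := PP.card_point_le
    rw [Nat.card_eq_fintype_card] at this
    rw [add_comm, Finset.card_add_card_compl]
    exact this
  rw [hRcoe]
  have hPc' : (R.card : ℝ) * (T.card * (q - 1) + 1) ≤ Tᶜ.card * (cov P).card := by
    have : ((R.card * (T.card * (q - 1) + 1) : ℕ) : ℝ) ≤ ((Tᶜ.card * (cov P).card : ℕ) : ℝ) := by
      exact_mod_cast hPc
    push_cast [Nat.cast_sub hq] at this
    exact this
  have hsplit' : ((PP.uncov (insert P (T : Set PP.Point))).ncard : ℝ) + (cov P).card ≤ R.card := by
    exact_mod_cast hsplit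
  have hN' : (Tᶜ.card : ℝ) + T.card ≤ q ^ 2 + q + 1 := by exact_mod_cast hN
  have hM : (Tᶜ.card : ℝ) ≤ q ^ 2 + q + 1 - T.card := by linarith
  have hM0 : (0 : ℝ) ≤ q ^ 2 + q + 1 - T.card := le_trans (by positivity) hM
  have h₁ := mul_le_mul_of_nonneg_right hsplit' hM0
  have h₂ := mul_le_mul_of_nonneg_right hM (Nat.cast_nonneg (α := ℝ) (cov P).card)
  nlinarith

theorem one_sub_add_sq_div_four_le_exp_neg {t : ℝ} (h0 : 0 ≤ t) (h1 : t ≤ 1) :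
    1 - t + t ^ 2 / 4 ≤ Real.exp (-t) := by
  have h := Real.exp_bound (x := -t) (by rw [abs_neg, abs_of_nonneg h0]; exact h1)
    (n := 3) (by norm_num)
  rw [abs_neg, abs_of_nonneg h0] at h
  have := (abs_le.1 h).1
  norm_num [Finset.sum_range_succ, Nat.factorial] at this
  nlinarith [mul_nonneg (sq_nonneg t) (sub_nonneg.2 h1), sq_nonneg t]

theorem uncovered_fraction_le_exp {d k : ℝ} (hk : 1 ≤ k) (hkd : k ≤ d) :
    (d ^ 2 - d + 1 - k) - (k * (d - 2) + 1) ≤ (d ^ 2 - d + 1 - k) * Real.exp (-(k / d)) := by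
  have hd : 0 < d := by linarith
  have hM : 0 ≤ d ^ 2 - d + 1 - k := by nlinarith
  have hexp := one_sub_add_sq_div_four_le_exp_neg (div_nonneg (by linarith) hd.le)
    ((div_le_one hd).2 hkd)
  refine le_trans ?_ (mul_le_mul_of_nonneg_left hexp hM)
  have hstep : 1 - k / d + (k - 1) / d ^ 2 ≤ 1 - k / d + (k / d) ^ 2 / 4 := by
    rw [div_pow, div_right_comm]
    gcongr
    nlinarith [sq_nonneg (k - 2)]
  refine le_trans ?_ (mul_le_mul_of_nonneg_left hstep hM)
  have hkey : (d ^ 2 - d + 1 - k) * (1 - k / d + (k - 1) / d ^ 2) -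
      ((d ^ 2 - d + 1 - k) - (k * (d - 2) + 1)) = (k - 1) ^ 2 * (d - 1) / d ^ 2 := by
    field_simp
    ring
  have : 0 ≤ (k - 1) ^ 2 * (d - 1) / d ^ 2 :=
    div_nonneg (mul_nonneg (sq_nonneg _) (by linarith)) (sq_nonneg _)
  linarith

theorem exists_pair_ncard_uncov_le :
    ∃ T : Finset PP.Point, T.card = 2 ∧ (PP.uncov (T : Set PP.Point)).ncard ≤ q ^ 2 := by
  classical
  have := PP.finite_point
  obtain ⟨A, B, -, -, hAB, -⟩ := PP.nondeg
  obtain ⟨l, ⟨hAl, hBl⟩, -⟩ := PP.line_unique A B hAB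
  refine ⟨{A, B}, Finset.card_pair hAB, ?_⟩
  have hsub : PP.uncov (({A, B} : Finset PP.Point) : Set PP.Point) ⊆ {P | PP.incid P l}ᶜ := by
    intro X hX hXl
    exact hAB (PP.eq_of_mem_uncov hX (by simp) (by simp) hAl hBl hXl)
  have h₁ := Set.ncard_le_ncard hsub (Set.toFinite _)
  have h₂ := Set.ncard_add_ncard_compl {P | PP.incid P l}
  rw [PP.ncard_points_on l] at h₂
  have := PP.card_point_le
  omega

/-- The greedy choice yields, for each `k`, either a saturating set of size at most `k` or a
`k`-set with few uncovered points. -/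
theorem exists_greedy (hq : 2 ≤ q) (k : ℕ) (hk : 2 ≤ k) (hkq : k ≤ q + 2) :
    (∃ S, PP.Saturating S ∧ S.ncard ≤ k) ∨
    ∃ T : Finset PP.Point, T.card = k ∧ ((PP.uncov (T : Set PP.Point)).ncard : ℝ) ≤
      q ^ 2 * Real.exp (-((k * (k - 1) - 2) / (2 * (q + 1)))) := by
  classical
  induction k, hk using Nat.le_induction with
  | base =>
    right
    obtain ⟨T, hT, hle⟩ := PP.exists_pair_ncard_uncov_le
    refine ⟨T, hT, ?_⟩
    norm_num
    exact_mod_cast hle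
  | succ k hk ih =>
    rcases ih (by omega) with ⟨S, hS, hcard⟩ | ⟨T, hT, hle⟩
    · exact Or.inl ⟨S, hS, by omega⟩
    rcases (PP.uncov (T : Set PP.Point)).eq_empty_or_nonempty with h | h
    · exact Or.inl ⟨T, PP.saturating_of_uncov_eq_empty h, by rw [Set.ncard_coe_finset]; omega⟩
    right
    obtain ⟨P, hP, hstep⟩ := PP.exists_insert_ncard_uncov_le (by omega) T h
    refine ⟨insert P T, by rw [Finset.card_insert_of_notMem hP, hT], ?_⟩
    rw [Finset.coe_insert]
    rw [hT] at hstep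
    have hk1 : (1 : ℝ) ≤ k := by exact_mod_cast (by omega : 1 ≤ k)
    have hkd : (k : ℝ) ≤ q + 1 := by exact_mod_cast (by omega : k ≤ q + 1)
    have hq2 : (2 : ℝ) ≤ q := by exact_mod_cast hq
    have hfrac := uncovered_fraction_le_exp hk1 hkd
    have hM : (0 : ℝ) < q ^ 2 + q + 1 - k := by nlinarith
    have hfrac' : ((q : ℝ) ^ 2 + q + 1 - k) - (k * (q - 1) + 1) ≤
        (q ^ 2 + q + 1 - k) * Real.exp (-(k / (q + 1))) := by
      convert hfrac using 2 <;> ring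
    have hnew : ((PP.uncov (insert P (T : Set PP.Point))).ncard : ℝ) ≤
        (PP.uncov (T : Set PP.Point)).ncard * Real.exp (-(k / (q + 1))) := by
      refine le_of_mul_le_mul_right ?_ hM
      have := mul_le_mul_of_nonneg_left hfrac'
        (Nat.cast_nonneg (α := ℝ) (PP.uncov (T : Set PP.Point)).ncard)
      linarith
    refine hnew.trans ((mul_le_mul_of_nonneg_right hle (Real.exp_pos _).le).trans_eq ?_)
    rw [mul_assoc, ← Real.exp_add]
    congr 2
    push_cast
    field_simp
    ring

end ProjPlane

theorem three_mul_log_le_add_one {x : ℝ} (hx : 0 < x) : 3 * Real.log x ≤ x + 1 := by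
  have h₁ := Real.log_le_sub_one_of_pos (show 0 < x / 3 by positivity)
  rw [Real.log_div hx.ne' (by norm_num)] at h₁
  have h₂ : Real.log 3 ≤ 4 / 3 := by
    rw [Real.log_le_iff_le_exp (by norm_num)]
    have := Real.quadratic_le_exp_of_nonneg (show (0 : ℝ) ≤ 4 / 3 by norm_num)
    linarith
  linarith

theorem sq_mul_exp_neg_le_sqrt {x z : ℝ} (hx : 0 < x) (hz : 3 / 2 * Real.log x ≤ z) :
    x ^ 2 * Real.exp (-z) ≤ Real.sqrt x := by
  calc x ^ 2 * Real.exp (-z) ≤ x ^ 2 * Real.exp (-(3 / 2 * Real.log x)) := by gcongr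
    _ = Real.sqrt x := by
      rw [Real.sqrt_eq_rpow, Real.rpow_def_of_pos hx]
      nth_rewrite 1 [← Real.exp_log hx]
      rw [← Real.exp_nat_mul, ← Real.exp_add]
      congr 1
      push_cast
      ring

theorem saturating_set_bound_xi_sqrt_q (q : ℕ) (hq : 2 ≤ q) (PP : ProjPlane q) :
    ∃ S : Set PP.Point, PP.Saturating S ∧
      (S.ncard : ℝ) ≤ Real.sqrt (3 * (q + 1) * Real.log q) + (1 / 2) * Real.sqrt q + 3 := by
  have hq2 : (2 : ℝ) ≤ q := by exact_mod_cast hq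
  have hq0 : (0 : ℝ) < q := by linarith
  have hlog : 0.6 ≤ Real.log q :=
    le_trans (by linarith [Real.log_two_gt_d9]) (Real.log_le_log (by norm_num) hq2)
  set y := Real.sqrt (3 * (q + 1) * Real.log q) with hy
  have hy0 : 0 ≤ y := Real.sqrt_nonneg _
  have hysq : y ^ 2 = 3 * (q + 1) * Real.log q := Real.sq_sqrt (by positivity)
  have hyq : y ≤ q + 1 := by
    refine Real.sqrt_le_iff.2 ⟨by linarith, ?_⟩
    nlinarith [three_mul_log_le_add_one hq0]
  have hy2 : 2 ≤ y := Real.le_sqrt_of_sq_le (by nlinarith)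
  have hceil := Nat.le_ceil y
  have hceil' := Nat.ceil_lt_add_one hy0
  have hceilq : ⌈y⌉₊ ≤ q + 1 := Nat.ceil_le.2 (by exact_mod_cast hyq)
  have hceil2 : 2 ≤ ⌈y⌉₊ := by exact_mod_cast hy2.trans hceil
  have hsqrt := Real.sqrt_nonneg (q : ℝ)
  rcases PP.exists_greedy hq (⌈y⌉₊ + 1) (by omega) (by omega) with ⟨S, hS, hcard⟩ | ⟨T, hT, hle⟩
  · refine ⟨S, hS, ?_⟩
    have : (S.ncard : ℝ) ≤ ⌈y⌉₊ + 1 := by exact_mod_cast hcard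
    linarith
  · have hr : ((PP.uncov (T : Set PP.Point)).ncard : ℝ) ≤ Real.sqrt q := by
      refine hle.trans (sq_mul_exp_neg_le_sqrt hq0 ?_)
      rw [le_div_iff₀ (by positivity)]
      push_cast
      nlinarith
    obtain ⟨S, hS, hcard⟩ := PP.exists_saturating_of_ncard_uncov_le
      (((PP.uncov (T : Set PP.Point)).ncard + 1) / 2) T
      (by rw [Set.ncard_coe_finset]; omega) (by omega)
    refine ⟨S, hS, ?_⟩
    rw [Set.ncard_coe_finset, hT] at hcard
    have : 2 * S.ncard ≤ 2 * (⌈y⌉₊ + 1) + ((PP.uncov (T : Set PP.Point)).ncard + 1) := by omega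
    have : 2 * (S.ncard : ℝ) ≤ 2 * (⌈y⌉₊ + 1) + ((PP.uncov (T : Set PP.Point)).ncard + 1) := by
      exact_mod_cast this
    linarith
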